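/- (Proposition 6, quantitative core.) Let 0 < f_L < c_H and δ ∈ (0,1) with δ > (c_H − f_L)/c_H, and let N = N(f_L, c_H, δ) be the least positive integer M with f_L(1−δ^M)/(1−δ) ≥ c_H. Then for every connected finite simple graph G on at least N+1 vertices, where each vertex provides benefit f_L, and for every vertex i of G, the utility of i satisfies u_i(G) = f_L · Σ_{j ≠ i} δ^{d(i,j)−1} − c_H ≥ 0. Hence in any component of size at least N+1, no high-type bacterium ever has an incentive to break its links. -/

import Mathlib

open Finset

/-- The critical size `N(f, c, δ)`: the least positive integer `M` such that
`f · (1 − δ^M)/(1 − δ) ≥ c`. -/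
noncomputable def critN (f c δ : ℝ) : ℕ :=
  sInf {M : ℕ | 0 < M ∧ f * (1 - δ ^ M) / (1 - δ) ≥ c}

lemma geom_le_sum_aux {V : Type*} [DecidableEq V] (δ : ℝ) (h0 : 0 < δ) (h1 : δ < 1) (g : V → ℕ)
    (n : ℕ) : ∀ S : Finset V, S.card = n →
    (∀ v ∈ S, ∀ k, k < g v → ∃ w ∈ S, g w = k) →
    ∑ k ∈ Finset.range n, δ ^ k ≤ ∑ v ∈ S, δ ^ g v := by
  induction n with
  | zero =>
    intro S hS _
    rw [Finset.card_eq_zero] at hS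
    simp [hS]
  | succ n ih =>
    intro S hS hcl
    have hne : S.Nonempty := by
      rw [← Finset.card_pos]; omega
    obtain ⟨m, hm, hmax⟩ := Finset.exists_max_image S g hne
    have hgm : g m ≤ n := by
      have hsub : Finset.range (g m + 1) ⊆ S.image g := by
        intro k hk
        rw [Finset.mem_range] at hk
        rw [Finset.mem_image]
        rcases Nat.lt_or_ge k (g m) with h | h
        · exact hcl m hm k h
        · exact ⟨m, hm, by omega⟩
      have h2 := Finset.card_le_card hsub
      have h3 := Finset.card_image_le (s := S) (f := g)
      rw [Finset.card_range] at h2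
      omega
    have hE := ih (S.erase m) (by rw [Finset.card_erase_of_mem hm]; omega) (by
      intro v hv k hk
      obtain ⟨w, hw, hwk⟩ := hcl v (Finset.mem_of_mem_erase hv) k hk
      refine ⟨w, Finset.mem_erase.2 ⟨?_, hw⟩, hwk⟩
      rintro rfl
      have := hmax v (Finset.mem_of_mem_erase hv)
      omega)
    rw [Finset.sum_range_succ, ← Finset.sum_erase_add S _ hm]
    exact add_le_add hE (pow_le_pow_of_le_one h0.le h1.le hgm)

lemma exists_dist_eq_aux {V : Type*} (G : SimpleGraph V) (hG : G.Connected) (i : V) (n : ℕ) :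
    ∀ j, G.dist i j = n → ∀ k ≤ n, ∃ w, G.dist i w = k := by
  intro j hj k hk
  obtain ⟨p, hp⟩ := hG.exists_walk_length_eq_dist i j
  refine ⟨p.getVert k, ?_⟩
  have h1 : G.dist i (p.getVert k) ≤ k :=
    (SimpleGraph.dist_le (p.take k)).trans (by simp [SimpleGraph.Walk.take_length])
  have h2 : G.dist (p.getVert k) j ≤ n - k :=
    (SimpleGraph.dist_le (p.drop k)).trans (by simp [SimpleGraph.Walk.drop_length]; omega)
  have h3 := hG.dist_triangle (u := i) (v := p.getVert k) (w := j)
  omega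

lemma critN_spec_aux (f c δ : ℝ) (hf : 0 < f) (hfc : f < c) (h0 : 0 < δ) (h1 : δ < 1)
    (h2 : (c - f) / c < δ) : f * (1 - δ ^ critN f c δ) / (1 - δ) ≥ c := by
  have hne : {M : ℕ | 0 < M ∧ f * (1 - δ ^ M) / (1 - δ) ≥ c}.Nonempty := by
    have hc : 0 < c := hf.trans hfc
    rw [div_lt_iff₀ hc] at h2
    have hpos : 0 < (f - c * (1 - δ)) / f := div_pos (by linarith) hf
    obtain ⟨M, hM⟩ := exists_pow_lt_of_lt_one hpos h1
    refine ⟨M + 1, Nat.succ_pos _, ?_⟩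
    have h3 : δ ^ (M + 1) ≤ δ ^ M := pow_le_pow_of_le_one h0.le h1.le (Nat.le_succ M)
    have h4 := h3.trans_lt hM
    rw [lt_div_iff₀ hf] at h4
    rw [ge_iff_le, le_div_iff₀ (by linarith)]
    linarith
  exact (Nat.sInf_mem hne).2

/-- Proposition 6, quantitative core: let `0 < f_L < c_H`,
`δ ∈ (0,1)` with `δ > (c_H − f_L)/c_H`, and `N = N(f_L, c_H, δ)`. Then for
every connected finite simple graph `G` on at least `N + 1` vertices, where
each vertex provides benefit `f_L`, and every vertex `i` of `G`, the utility
`u_i(G) = f_L · Σ_{j ≠ i} δ^(d(i,j)−1) − c_H` is nonnegative. -/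
theorem stmt_9 (f_L c_H δ : ℝ) (hfL : 0 < f_L) (hfc : f_L < c_H)
    (hδ0 : 0 < δ) (hδ1 : δ < 1) (hδ2 : (c_H - f_L) / c_H < δ)
    {V : Type*} [Fintype V] [DecidableEq V] (G : SimpleGraph V)
    (hG : G.Connected) (hcard : critN f_L c_H δ + 1 ≤ Fintype.card V) (i : V) :
    f_L * ∑ j ∈ Finset.univ.filter (· ≠ i), δ ^ (G.dist i j - 1) - c_H ≥ 0 := by
  have hS : (Finset.univ.filter (· ≠ i)).card = Fintype.card V - 1 := by
    rw [Finset.filter_ne', Finset.card_erase_of_mem (Finset.mem_univ i), Finset.card_univ]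
  have hmain := geom_le_sum_aux δ hδ0 hδ1 (fun j => G.dist i j - 1) _
    (Finset.univ.filter (· ≠ i)) hS (by
      intro v hv k hk
      obtain ⟨w, hw⟩ := exists_dist_eq_aux G hG i _ v rfl (k + 1) (by omega)
      refine ⟨w, ?_, by simp [hw]⟩
      simp only [Finset.mem_filter, Finset.mem_univ, true_and]
      rintro rfl
      simp at hw)
  have hmono : ∑ k ∈ Finset.range (critN f_L c_H δ), δ ^ k
      ≤ ∑ k ∈ Finset.range (Fintype.card V - 1), δ ^ k :=
    Finset.sum_le_sum_of_subset_of_nonneg (Finset.range_mono (by omega))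
      (fun k _ _ => pow_nonneg hδ0.le k)
  have hspec := critN_spec_aux f_L c_H δ hfL hfc hδ0 hδ1 hδ2
  have hgeo : ∑ k ∈ Finset.range (critN f_L c_H δ), δ ^ k
      = (1 - δ ^ critN f_L c_H δ) / (1 - δ) := by
    rw [eq_div_iff (by linarith)]
    exact geom_sum_mul_neg δ _
  rw [mul_div_assoc, ← hgeo] at hspec
  have := mul_le_mul_of_nonneg_left (hmono.trans hmain) hfL.le
  linarith
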